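/- Energy bound for a (Lemma 6.3(iv)): Let s > (d+1)/2 and k ≥ 0. There is a constant C, depending on d, s and k, such that for every holomorphic R ∈ H^{k,1/2}(𝕋^d) ∩ H^{s,1/2}(𝕋^d), the function a := i(P̄[conj(R)·∂_α R] − P[R·∂_α conj(R)]) satisfies ‖a‖_{H^{k,1/2}} ≤ C ‖R‖_{H^{k,1/2}} ‖R‖_{H^{s,1/2}}. -/

import Mathlib

noncomputable section
open scoped BigOperators
open Filter

/-- The frequency lattice `ℤ^d` of the torus `𝕋^d`. -/
abbrev Freq (d : ℕ) := Fin d → ℤ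

/-- A function on `𝕋^d`, represented by its sequence of Fourier coefficients. -/
abbrev Coeffs (d : ℕ) := Freq d → ℂ

variable {d : ℕ}

/-- The pairing `⟨j, k⟩` between a lattice frequency and the frequency vector `k ∈ ℝ^d`. -/
def dotk (k : Fin d → ℝ) (j : Freq d) : ℝ := ∑ i, (j i : ℝ) * k i

/-- The Japanese bracket `⟨j⟩ = (1+|j|²)^{1/2}`. -/
def jb (j : Freq d) : ℝ := Real.sqrt (1 + ∑ i, ((j i : ℝ)) ^ 2)

/-- The entries of `k` are linearly independent over `ℚ` (equivalently, over `ℤ`). -/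
def Indep (k : Fin d → ℝ) : Prop := ∀ j : Freq d, dotk k j = 0 → j = 0

/-- The weight defining the anisotropic Sobolev norm `H^{s,θ}`. -/
def wt (k : Fin d → ℝ) (s θ : ℝ) (j : Freq d) : ℝ :=
  jb j ^ (2 * s) * (1 + (dotk k j) ^ 2) ^ θ

/-- Membership in the anisotropic Sobolev space `H^{s,θ}(𝕋^d)`. -/
def MemSob (k : Fin d → ℝ) (s θ : ℝ) (u : Coeffs d) : Prop :=
  Summable (fun j : Freq d => wt k s θ j * ‖u j‖ ^ 2)

/-- The `H^{s,θ}(𝕋^d)` norm. -/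
def sobNorm (k : Fin d → ℝ) (s θ : ℝ) (u : Coeffs d) : ℝ :=
  Real.sqrt (∑' j : Freq d, wt k s θ j * ‖u j‖ ^ 2)

/-- Membership in the Sobolev space `H^s(𝕋^d)`; `H^0 = L²`. -/
def MemHs (s : ℝ) (u : Coeffs d) : Prop :=
  Summable (fun j : Freq d => jb j ^ (2 * s) * ‖u j‖ ^ 2)

/-- The `H^s(𝕋^d)` norm; for `s = 0` this is the `L²(𝕋^d)` norm (spectrally normalized). -/
def HsNorm (s : ℝ) (u : Coeffs d) : ℝ :=
  Real.sqrt (∑' j : Freq d, jb j ^ (2 * s) * ‖u j‖ ^ 2)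

/-- The value of the function with Fourier coefficients `u` at the point `α ∈ 𝕋^d = ℝ^d/(2πℤ)^d`,
namely `Σ_j û_j e^{i⟨j,α⟩}`. -/
def value (u : Coeffs d) (α : Fin d → ℝ) : ℂ :=
  ∑' j : Freq d, u j * Complex.exp (Complex.I * ((∑ i, (j i : ℝ) * α i : ℝ) : ℂ))

/-- The squared norm of the space `ℋ^σ = H^σ × H^{σ,1/2}`. -/
def HHnormSq (k : Fin d → ℝ) (σ : ℝ) (W R : Coeffs d) : ℝ :=
  HsNorm σ W ^ 2 + sobNorm k σ (1/2) R ^ 2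

/-- The norm of the space `ℋ^σ = H^σ × H^{σ,1/2}`. -/
def HHnorm (k : Fin d → ℝ) (σ : ℝ) (W R : Coeffs d) : ℝ :=
  Real.sqrt (HHnormSq k σ W R)

/-- Membership in `ℋ^σ = H^σ × H^{σ,1/2}`. -/
def MemHH (k : Fin d → ℝ) (σ : ℝ) (W R : Coeffs d) : Prop :=
  MemHs σ W ∧ MemSob k σ (1/2) R

/-- The directional derivative `∂_α = k₁∂₁+⋯+k_d∂_d`, acting on Fourier coefficients
by multiplication by `i⟨j,k⟩`. -/
def dAl (k : Fin d → ℝ) (u : Coeffs d) : Coeffs d :=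
  fun j => Complex.I * (dotk k j : ℝ) * u j

/-- The projection `P`: the Fourier multiplier which is `1` for `⟨j,k⟩ < 0`, `1/2`
at the zero mode, `0` for `⟨j,k⟩ > 0`. -/
def Pp (k : Fin d → ℝ) (u : Coeffs d) : Coeffs d := fun j =>
  if dotk k j < 0 then u j else if dotk k j = 0 then u j / 2 else 0

/-- The complementary projection `P̄ = I - P`. -/
def Pb (k : Fin d → ℝ) (u : Coeffs d) : Coeffs d := u - Pp k u

/-- The Fourier coefficients of the complex conjugate function. -/
def conjC (u : Coeffs d) : Coeffs d := fun j => (starRingEnd ℂ) (u (-j))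

/-- The Fourier coefficients of the product of two functions (convolution). -/
def cmul (u v : Coeffs d) : Coeffs d := fun j => ∑' m : Freq d, u m * v (j - m)

/-- The Fourier coefficients of the constant function `1`. -/
def oneC : Coeffs d := fun j => if j = 0 then 1 else 0

/-- `u` is holomorphic: its Fourier coefficients vanish for `⟨j,k⟩ > 0`. -/
def Holo (k : Fin d → ℝ) (u : Coeffs d) : Prop := ∀ j : Freq d, 0 < dotk k j → u j = 0

/-- The coefficients of `2 Re u`. -/
def twoRe (u : Coeffs d) : Coeffs d := u + conjC u

/-- The coefficients of `2 Im u`. -/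
def twoIm (u : Coeffs d) : Coeffs d := fun j => (u j - conjC u j) / Complex.I

/-- The coefficients of `u²`. -/
def csq (u : Coeffs d) : Coeffs d := cmul u u

/-- The coefficients of `|u|² = u·conj(u)`. -/
def absSqC (u : Coeffs d) : Coeffs d := cmul u (conjC u)

/-- The advection velocity `b := 2 Re P[R(1-conj Y)]`. -/
def bC (k : Fin d → ℝ) (R Y : Coeffs d) : Coeffs d :=
  twoRe (Pp k (cmul R (oneC - conjC Y)))

/-- The frequency shift `a := i(P̄[conj(R)·R_α] - P[R·conj(R)_α])`. -/
def aCf (k : Fin d → ℝ) (R : Coeffs d) : Coeffs d := fun j =>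
  Complex.I * ((Pb k (cmul (conjC R) (dAl k R)) - Pp k (cmul R (dAl k (conjC R)))) j)

/-- The auxiliary function
`M := P̄[conj(R)·Y_α − R_α·conj(Y)] + P[R·conj(Y)_α − conj(R)_α·Y]`. -/
def MCf (k : Fin d → ℝ) (R Y : Coeffs d) : Coeffs d :=
  Pb k (cmul (conjC R) (dAl k Y) - cmul (dAl k R) (conjC Y))
    + Pp k (cmul R (dAl k (conjC Y)) - cmul (dAl k (conjC R)) Y)

/-- `(W,R,Y)` solves the differentiated gravity water wave system on the time interval `I`:
`𝐖_t + b·𝐖_α + (1+𝐖)(1−conj Y)·R_α = (1+𝐖)M` and `R_t + b·R_α = i(Y − a(1−Y))`,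
where `Y = 𝐖/(1+𝐖)` (equivalently `(1+𝐖)·Y = 𝐖`), so that
`(1+𝐖)/(1+conj 𝐖) = (1+𝐖)(1−conj Y)` and `i(𝐖−a)/(1+𝐖) = i(Y − a(1−Y))`. -/
structure IsWWSol (k : Fin d → ℝ) (I : Set ℝ) (W R Y : ℝ → Coeffs d) : Prop where
  holoW : ∀ t ∈ I, Holo k (W t)
  holoR : ∀ t ∈ I, Holo k (R t)
  Ymem : ∀ t ∈ I, MemHs 0 (Y t)
  Ydef : ∀ t ∈ I, cmul (oneC + W t) (Y t) = W t
  eqW : ∀ t ∈ I, ∀ j : Freq d,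
    HasDerivWithinAt (fun τ => W τ j)
      ((cmul (oneC + W t) (MCf k (R t) (Y t))
        - cmul (bC k (R t) (Y t)) (dAl k (W t))
        - cmul (cmul (oneC + W t) (oneC - conjC (Y t))) (dAl k (R t))) j) I t
  eqR : ∀ t ∈ I, ∀ j : Freq d,
    HasDerivWithinAt (fun τ => R τ j)
      ((Complex.I • (Y t - cmul (aCf k (R t)) (oneC - Y t))
        - cmul (bC k (R t) (Y t)) (dAl k (R t))) j) I t

open scoped ENNReal in
lemma two_ab (a b : ℝ≥0∞) : 2*(a*b) ≤ a^2+b^2 := by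
  rcases eq_or_ne a ⊤ with rfl | ha
  · simp
  rcases eq_or_ne b ⊤ with rfl | hb
  · simp
  lift a to NNReal using ha
  lift b to NNReal using hb
  have := two_mul_le_add_sq a b
  rw [mul_assoc] at this
  exact_mod_cast this

open scoped ENNReal in
lemma cs {ι : Type*} (g f : ι → ℝ≥0∞) : (∑' m, g m * f m)^2 ≤ (∑' m, g m) * ∑' m, g m * (f m)^2 := by
  have h2 : 2 * (∑' m, g m * f m)^2 ≤ 2 * ((∑' m, g m) * ∑' m, g m * (f m)^2) := by
    have e1 : 2 * (∑' m, g m * f m)^2 = ∑' m, ∑' n, g m * g n * (2 * (f m * f n)) := by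
      rw [sq, ← ENNReal.tsum_mul_right, ← ENNReal.tsum_mul_left]
      refine tsum_congr fun m => ?_
      rw [← ENNReal.tsum_mul_left, ← ENNReal.tsum_mul_left]
      refine tsum_congr fun n => ?_
      ring
    have e3 : (∑' m, g m) * (∑' m, g m * (f m)^2) = ∑' m, ∑' n, g m * g n * (f n)^2 := by
      rw [← ENNReal.tsum_mul_right]
      refine tsum_congr fun m => ?_
      rw [← ENNReal.tsum_mul_left]
      refine tsum_congr fun n => ?_
      ring
    have e4 : (∑' m, g m) * (∑' m, g m * (f m)^2) = ∑' m, ∑' n, g m * g n * (f m)^2 := by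
      rw [e3, ENNReal.tsum_comm]
      refine tsum_congr fun m => tsum_congr fun n => ?_
      ring
    rw [e1, two_mul ((∑' m, g m) * _)]
    nth_rewrite 1 [e4]
    rw [e3, ← ENNReal.tsum_add]
    refine ENNReal.tsum_le_tsum fun m => ?_
    rw [← ENNReal.tsum_add]
    refine ENNReal.tsum_le_tsum fun n => ?_
    rw [← mul_add]
    gcongr
    exact two_ab _ _
  exact (ENNReal.mul_le_mul_iff_right (by simp) (by simp)).1 h2

open scoped ENNReal in
lemma young {G : Type*} [AddCommGroup G] (f g : G → ℝ≥0∞) :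
    ∑' j, (∑' m, g m * f (j - m))^2 ≤ (∑' m, g m)^2 * ∑' m, (f m)^2 := by
  calc ∑' j, (∑' m, g m * f (j - m))^2 
      ≤ ∑' j, (∑' m, g m) * ∑' m, g m * (f (j-m))^2 := ENNReal.tsum_le_tsum fun j => cs _ _
    _ = (∑' m, g m) * ∑' m, ∑' j, g m * (f (j-m))^2 := by
        rw [ENNReal.tsum_mul_left, ENNReal.tsum_comm]
    _ = (∑' m, g m) * ∑' m, g m * ∑' j, (f j)^2 := by
        congr 1
        refine tsum_congr fun m => ?_
        rw [ENNReal.tsum_mul_left]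
        congr 1
        exact (Equiv.subRight m).tsum_eq (fun j => (f j)^2)
    _ = _ := by rw [ENNReal.tsum_mul_right]; ring

open scoped ENNReal in
lemma young' {G : Type*} [AddCommGroup G] (f g : G → ℝ≥0∞) :
    ∑' j, (∑' m, f m * g (j - m))^2 ≤ (∑' m, g m)^2 * ∑' m, (f m)^2 := by
  refine le_trans (le_of_eq ?_) (young f g)
  refine tsum_congr fun j => ?_
  congr 1
  rw [← (Equiv.subLeft j).tsum_eq]
  refine tsum_congr fun m => ?_
  simp [mul_comm]

def ww (k : Fin d → ℝ) (j : Freq d) : ℝ := (1 + (dotk k j)^2) ^ (1/4 : ℝ)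

lemma dotk_sub (k : Fin d → ℝ) (a b : Freq d) : dotk k (a - b) = dotk k a - dotk k b := by
  simp [dotk, sub_mul, Finset.sum_sub_distrib]

lemma dotk_neg (k : Fin d → ℝ) (a : Freq d) : dotk k (-a) = - dotk k a := by
  simp [dotk]

lemma jb_sq (j : Freq d) : jb j ^ 2 = 1 + ∑ i, ((j i : ℝ)) ^ 2 := by
  rw [jb, Real.sq_sqrt]; positivity

lemma jb_ge_one (j : Freq d) : 1 ≤ jb j := by
  rw [jb]; apply Real.one_le_sqrt.2
  have : 0 ≤ ∑ i, ((j i : ℝ)) ^ 2 := by positivity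
  linarith

lemma jb_pos (j : Freq d) : 0 < jb j := lt_of_lt_of_le one_pos (jb_ge_one j)

lemma jb_neg (j : Freq d) : jb (-j) = jb j := by simp [jb]

lemma jb_sub (p n : Freq d) : jb (n - p) ≤ 2 * max (jb p) (jb n) := by
  have h : jb (n - p) ^ 2 ≤ 2 * (jb p ^ 2 + jb n ^ 2) := by
    rw [jb_sq, jb_sq, jb_sq]
    have : ∑ i, (((n - p) i : ℤ) : ℝ) ^ 2 ≤ ∑ i, (2 * (p i : ℝ)^2 + 2 * (n i : ℝ)^2) := by
      refine Finset.sum_le_sum fun i _ => ?_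
      simp only [Pi.sub_apply, Int.cast_sub]
      nlinarith [sq_nonneg ((n i : ℝ) + p i)]
    rw [Finset.sum_add_distrib, ← Finset.mul_sum, ← Finset.mul_sum] at this
    linarith
  have hp := jb_pos p
  have hn := jb_pos n
  have h1 : jb p ^ 2 ≤ (max (jb p) (jb n))^2 := by gcongr; exact le_max_left _ _
  have h2 : jb n ^ 2 ≤ (max (jb p) (jb n))^2 := by gcongr; exact le_max_right _ _
  have h0 : 0 ≤ max (jb p) (jb n) := le_max_of_le_left hp.le
  apply le_of_sq_le_sq _ (by positivity)
  nlinarith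

lemma ww_pos (k : Fin d → ℝ) (j : Freq d) : 0 < ww k j := by unfold ww; positivity

lemma ww_mono (k : Fin d → ℝ) (j p : Freq d) (h : |dotk k j| ≤ |dotk k p|) : ww k j ≤ ww k p := by
  unfold ww
  have := sq_le_sq.2 h
  gcongr

lemma ww_sq (k : Fin d → ℝ) (j : Freq d) : ww k j ^ 2 = (1 + (dotk k j)^2) ^ (1/2 : ℝ) := by
  unfold ww
  rw [← Real.rpow_natCast, ← Real.rpow_mul (by positivity)]; norm_num

lemma dotk_le_ww (k : Fin d → ℝ) (j : Freq d) : |dotk k j| ≤ ww k j ^ 2 := by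
  rw [ww_sq, ← Real.sqrt_eq_rpow]
  apply Real.abs_le_sqrt; linarith

lemma keyR (k : Fin d → ℝ) (κ : ℝ) (hκ : 0 ≤ κ) (p n j : Freq d)
    (hj : jb j ≤ 2 * max (jb p) (jb n)) (h1 : |dotk k j| ≤ |dotk k p|)
    (h2 : |dotk k n| ≤ |dotk k p|) (P N : ℝ) (hP : 0 ≤ P) (hN : 0 ≤ N) :
    jb j ^ κ * ww k j * (|dotk k n| * (P * N)) ≤
      2 ^ κ * ((jb p ^ κ * ww k p * P) * (ww k n ^ 2 * N)
        + (ww k p ^ 2 * P) * (jb n ^ κ * ww k n * N)) := by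
  have hp := jb_pos p
  have hn := jb_pos n
  have hjj := jb_pos j
  have wp := ww_pos k p
  have wn := ww_pos k n
  have wj := ww_pos k j
  have wjp := ww_mono k j p h1
  have wnp := ww_mono k n p h2
  have dn := dotk_le_ww k n
  have hJ : jb j ^ κ ≤ 2 ^ κ * max (jb p) (jb n) ^ κ := by
    rw [← Real.mul_rpow (by norm_num) (le_max_of_le_left hp.le)]
    gcongr
  rcases le_total (jb n) (jb p) with hh | hh
  · rw [max_eq_left hh] at hJ
    calc jb j ^ κ * ww k j * (|dotk k n| * (P * N)) 
        ≤ (2 ^ κ * jb p ^ κ) * ww k p * (ww k n ^ 2 * (P * N)) := by gcongr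
      _ = 2 ^ κ * ((jb p ^ κ * ww k p * P) * (ww k n ^ 2 * N) + 0) := by ring
      _ ≤ _ := by gcongr; positivity
  · rw [max_eq_right hh] at hJ
    calc jb j ^ κ * ww k j * (|dotk k n| * (P * N)) 
        ≤ (2 ^ κ * jb n ^ κ) * ww k p * ((ww k p * ww k n) * (P * N)) := by
          gcongr
          calc _ ≤ ww k n ^2 := dn
            _ = ww k n * ww k n := by ring
            _ ≤ _ := by gcongr
      _ = 2 ^ κ * (0 + (ww k p ^ 2 * P) * (jb n ^ κ * ww k n * N)) := by ring
      _ ≤ _ := by gcongr; positivity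

open scoped ENNReal in
def AA (k : Fin d → ℝ) (κ : ℝ) (R : Coeffs d) (p : Freq d) : ℝ≥0∞ :=
  ENNReal.ofReal (jb p ^ κ * ww k p * ‖R p‖)

open scoped ENNReal in
def BB (k : Fin d → ℝ) (R : Coeffs d) (p : Freq d) : ℝ≥0∞ :=
  ENNReal.ofReal (ww k p ^ 2 * ‖R p‖)

lemma termbound (k : Fin d → ℝ) (κ : ℝ) (hκ : 0 ≤ κ) (R : Coeffs d) (hR : Holo k R)
    (p n j : Freq d) (hj : j = n - p ∨ j = p - n) (hd : dotk k p = dotk k n - |dotk k j|) :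
    ENNReal.ofReal (jb j ^ κ * ww k j) * ENNReal.ofReal (|dotk k n| * (‖R p‖ * ‖R n‖)) ≤
      ENNReal.ofReal (2 ^ κ) * (AA k κ R p * BB k R n + BB k R p * AA k κ R n) := by
  by_cases hn : 0 < dotk k n
  · simp [hR n hn]
  have hpj := jb_pos j
  have hpp := jb_pos p
  have hpn := jb_pos n
  have wj := ww_pos k j
  have wp := ww_pos k p
  have wn := ww_pos k n
  unfold AA BB
  rw [← ENNReal.ofReal_mul (by positivity), ← ENNReal.ofReal_mul (by positivity),
    ← ENNReal.ofReal_mul (by positivity), ← ENNReal.ofReal_add (by positivity) (by positivity),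
    ← ENNReal.ofReal_mul (by positivity)]
  apply ENNReal.ofReal_le_ofReal
  push Not at hn
  have ha := abs_nonneg (dotk k j)
  have ep : |dotk k p| = - dotk k p := abs_of_nonpos (by linarith)
  have en : |dotk k n| = - dotk k n := abs_of_nonpos (by linarith)
  apply keyR k κ hκ p n j _ (by rw [ep]; linarith) (by rw [ep, en]; linarith) _ _
    (norm_nonneg _) (norm_nonneg _)
  rcases hj with rfl | rfl
  · exact jb_sub p n
  · rw [← neg_sub, jb_neg]; exact jb_sub p n

lemma c1bound (k : Fin d → ℝ) (κ : ℝ) (hκ : 0 ≤ κ) (R : Coeffs d) (hR : Holo k R)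
    (j : Freq d) (hj : 0 ≤ dotk k j) :
    ENNReal.ofReal (jb j ^ κ * ww k j) * ‖cmul (conjC R) (dAl k R) j‖ₑ ≤
      ENNReal.ofReal (2 ^ κ) * (∑' m, AA k κ R (-m) * BB k R (j - m)
        + ∑' m, BB k R (-m) * AA k κ R (j - m)) := by
  rw [← ENNReal.tsum_add, ← ENNReal.tsum_mul_left]
  unfold cmul
  refine (mul_le_mul_right enorm_tsum_le_tsum_enorm _).trans ?_
  rw [← ENNReal.tsum_mul_left]
  refine ENNReal.tsum_le_tsum fun m => ?_
  refine le_trans (le_of_eq ?_) (termbound k κ hκ R hR (-m) (j - m) j (Or.inl (by abel)) ?_)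
  · congr 1
    rw [← ofReal_norm]
    congr 1
    simp [conjC, dAl]
    ring
  · rw [abs_of_nonneg hj, dotk_sub, dotk_neg]; ring

lemma c2bound (k : Fin d → ℝ) (κ : ℝ) (hκ : 0 ≤ κ) (R : Coeffs d) (hR : Holo k R)
    (j : Freq d) (hj : dotk k j ≤ 0) :
    ENNReal.ofReal (jb j ^ κ * ww k j) * ‖cmul R (dAl k (conjC R)) j‖ₑ ≤
      ENNReal.ofReal (2 ^ κ) * (∑' m, AA k κ R m * BB k R (-(j - m))
        + ∑' m, BB k R m * AA k κ R (-(j - m))) := by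
  rw [← ENNReal.tsum_add, ← ENNReal.tsum_mul_left]
  unfold cmul
  refine (mul_le_mul_right enorm_tsum_le_tsum_enorm _).trans ?_
  rw [← ENNReal.tsum_mul_left]
  refine ENNReal.tsum_le_tsum fun m => ?_
  refine le_trans (le_of_eq ?_) (termbound k κ hκ R hR m (-(j - m)) j (Or.inr (by abel)) ?_)
  · congr 1
    rw [← ofReal_norm]
    congr 1
    simp only [conjC, dAl, dotk_neg, abs_neg]
    simp
    ring
  · rw [abs_of_nonpos hj, dotk_neg, dotk_sub]; ring

lemma enorm_aCf (k : Fin d → ℝ) (R : Coeffs d) (j : Freq d) :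
    (0 ≤ dotk k j ∧ ‖aCf k R j‖ₑ ≤ ‖cmul (conjC R) (dAl k R) j‖ₑ) ∨
    (dotk k j ≤ 0 ∧ ‖aCf k R j‖ₑ ≤ ‖cmul R (dAl k (conjC R)) j‖ₑ) ∨
    (dotk k j = 0 ∧ ‖aCf k R j‖ₑ ≤ ‖cmul (conjC R) (dAl k R) j‖ₑ + ‖cmul R (dAl k (conjC R)) j‖ₑ) := by
  rcases lt_trichotomy (dotk k j) 0 with h | h | h
  · right; left
    refine ⟨h.le, le_of_eq ?_⟩
    rw [← ofReal_norm, ← ofReal_norm]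
    simp [aCf, Pb, Pp, h]
  · right; right
    refine ⟨h, ?_⟩
    rw [← ofReal_norm, ← ofReal_norm, ← ofReal_norm,
      ← ENNReal.ofReal_add (norm_nonneg _) (norm_nonneg _)]
    apply ENNReal.ofReal_le_ofReal
    simp only [aCf, Pb, Pp, h, Pi.sub_apply, lt_irrefl, if_false, if_true, norm_mul,
      Complex.norm_I, one_mul]
    generalize cmul (conjC R) (dAl k R) j = x
    generalize cmul R (dAl k (conjC R)) j = y
    calc ‖x - x / 2 - y / 2‖ = ‖x / 2 - y / 2‖ := by congr 1; ring
      _ ≤ ‖x / 2‖ + ‖y / 2‖ := norm_sub_le _ _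
      _ ≤ _ := by
        simp only [norm_div, Complex.norm_ofNat]
        linarith [norm_nonneg x, norm_nonneg y]
  · left
    refine ⟨h.le, le_of_eq ?_⟩
    rw [← ofReal_norm, ← ofReal_norm]
    simp [aCf, Pb, Pp, h.not_gt, h.ne']

lemma abound (k : Fin d → ℝ) (κ : ℝ) (hκ : 0 ≤ κ) (R : Coeffs d) (hR : Holo k R) (j : Freq d) :
    AA k κ (aCf k R) j ≤ ENNReal.ofReal (2 ^ κ) *
      ((∑' m, AA k κ R (-m) * BB k R (j - m) + ∑' m, BB k R (-m) * AA k κ R (j - m)) +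
       (∑' m, AA k κ R m * BB k R (-(j - m)) + ∑' m, BB k R m * AA k κ R (-(j - m)))) := by
  have e : AA k κ (aCf k R) j = ENNReal.ofReal (jb j ^ κ * ww k j) * ‖aCf k R j‖ₑ := by
    have := jb_pos j
    have := ww_pos k j
    rw [AA, ENNReal.ofReal_mul (by positivity), ofReal_norm]
  rw [e, mul_add]
  rcases enorm_aCf k R j with ⟨h, h'⟩ | ⟨h, h'⟩ | ⟨h, h'⟩
  · exact ((mul_le_mul_right h' _).trans (c1bound k κ hκ R hR j h)).trans le_self_add
  · exact ((mul_le_mul_right h' _).trans (c2bound k κ hκ R hR j h)).trans le_add_self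
  · refine (mul_le_mul_right h' _).trans ?_
    rw [mul_add]
    exact add_le_add (c1bound k κ hκ R hR j h.ge) (c2bound k κ hκ R hR j h.le)

open scoped ENNReal in
lemma sq_add4 (a b c e : ℝ≥0∞) : ((a + b) + (c + e))^2 ≤ 4 * ((a^2 + b^2) + (c^2 + e^2)) := by
  have h2 : ∀ x y : ℝ≥0∞, (x + y)^2 ≤ 2 * (x^2 + y^2) := fun x y => by
    calc (x + y)^2 = x^2 + y^2 + 2 * (x*y) := by ring
      _ ≤ x^2 + y^2 + (x^2 + y^2) := by gcongr; exact two_ab x y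
      _ = _ := by ring
  calc _ ≤ 2 * ((a+b)^2 + (c+e)^2) := h2 _ _
    _ ≤ 2 * (2 * (a^2+b^2) + 2 * (c^2+e^2)) := by gcongr <;> exact h2 _ _
    _ = _ := by ring

lemma asum (k : Fin d → ℝ) (κ : ℝ) (hκ : 0 ≤ κ) (R : Coeffs d) (hR : Holo k R) :
    ∑' j, AA k κ (aCf k R) j ^ 2 ≤ ENNReal.ofReal (2 ^ κ) ^ 2 * 16 *
      ((∑' m, BB k R m)^2 * ∑' m, AA k κ R m ^ 2) := by
  have eB : ∑' m, BB k R (-m) = ∑' m, BB k R m := (Equiv.neg _).tsum_eq (BB k R)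
  have eA : ∑' m, AA k κ R (-m) ^ 2 = ∑' m, AA k κ R m ^ 2 :=
    (Equiv.neg _).tsum_eq (fun m => AA k κ R m ^ 2)
  calc _ ≤ ∑' j, ENNReal.ofReal (2 ^ κ) ^ 2 * (4 *
      (((∑' m, AA k κ R (-m) * BB k R (j - m))^2 + (∑' m, BB k R (-m) * AA k κ R (j - m))^2) +
       ((∑' m, AA k κ R m * BB k R (-(j - m)))^2 + (∑' m, BB k R m * AA k κ R (-(j - m)))^2))) := by
        refine ENNReal.tsum_le_tsum fun j => ?_
        refine (pow_le_pow_left' (abound k κ hκ R hR j) 2).trans ?_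
        rw [mul_pow]
        gcongr
        exact sq_add4 _ _ _ _
    _ ≤ ENNReal.ofReal (2 ^ κ) ^ 2 * (4 * 
          (((∑' m, BB k R m)^2 * (∑' m, AA k κ R m ^ 2) + (∑' m, BB k R m)^2 * ∑' m, AA k κ R m ^ 2)
          + ((∑' m, BB k R m)^2 * (∑' m, AA k κ R m ^ 2)
            + (∑' m, BB k R m)^2 * ∑' m, AA k κ R m ^ 2))) := by
        rw [ENNReal.tsum_mul_left, ENNReal.tsum_mul_left, ENNReal.tsum_add, ENNReal.tsum_add,
          ENNReal.tsum_add]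
        have y1 := young' (fun m => AA k κ R (-m)) (BB k R)
        have y2 := young (AA k κ R) (fun m => BB k R (-m))
        have y3 := young' (AA k κ R) (fun m => BB k R (-m))
        have y4 := young (fun m => AA k κ R (-m)) (BB k R)
        rw [eB] at y2 y3
        rw [eA] at y1 y4
        gcongr
    _ = _ := by ring

lemma AA_sq (k : Fin d → ℝ) (κ : ℝ) (u : Coeffs d) (j : Freq d) :
    AA k κ u j ^ 2 = ENNReal.ofReal (wt k κ (1/2) j * ‖u j‖ ^ 2) := by
  have := jb_pos j
  have := ww_pos k j
  rw [AA, ← ENNReal.ofReal_pow (by positivity), wt, ← ww_sq]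
  congr 1
  rw [two_mul, Real.rpow_add (by positivity)]
  ring

lemma jb_summable (r : ℝ) (hr : r < -(d : ℝ)) : Summable (fun j : Freq d => jb j ^ r) := by
  let L := Submodule.span ℤ (Set.range (Pi.basisFun ℝ (Fin d)))
  have hfr : Module.finrank ℤ L = d := by
    rw [ZLattice.rank ℝ L]; simp
  have hS := ZLattice.summable_norm_rpow L r (by rw [hfr]; exact hr)
  have hmem : ∀ j : Freq d, (fun i => (j i : ℝ)) ∈ L := by
    intro j
    rw [(Pi.basisFun ℝ (Fin d)).mem_span_iff_repr_mem ℤ]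
    intro i
    exact ⟨j i, by simp⟩
  let φ : Freq d → L := fun j => ⟨fun i => (j i : ℝ), hmem j⟩
  have hφ : Function.Injective φ := by
    intro a b h
    have := congrArg Subtype.val h
    funext i
    have h3 : (a i : ℝ) = (b i : ℝ) := congrFun this i
    exact_mod_cast h3
  have hS2 := hS.comp_injective hφ
  refine Summable.of_norm_bounded_eventually hS2 ?_
  refine (Set.finite_singleton (0 : Freq d)).subset ?_
  intro j hj
  by_contra hne
  apply hj
  have hpos : 0 < ‖φ j‖ := by
    rw [norm_pos_iff]
    intro h0
    apply hne
    have := congrArg Subtype.val h0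
    funext i
    have h3 : (j i : ℝ) = 0 := congrFun this i
    exact_mod_cast h3
  have hle : ‖φ j‖ ≤ jb j := by
    change ‖(fun i => (j i : ℝ))‖ ≤ jb j
    rw [pi_norm_le_iff_of_nonneg (jb_pos j).le]
    intro i
    apply Real.abs_le_sqrt
    have := Finset.single_le_sum (f := fun i => (j i : ℝ)^2) (fun i _ => sq_nonneg _) (Finset.mem_univ i)
    linarith
  have := jb_pos j
  change ‖jb j ^ r‖ ≤ ‖φ j‖ ^ r
  rw [Real.norm_of_nonneg (by positivity)]
  apply Real.rpow_le_rpow_of_nonpos hpos hle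
  have : (0:ℝ) ≤ d := Nat.cast_nonneg d
  linarith

lemma ww_sq_le (k : Fin d → ℝ) : ∃ K : ℝ, 0 ≤ K ∧ ∀ j : Freq d, ww k j ^ 2 ≤ K * jb j := by
  refine ⟨Real.sqrt (1 + ∑ i, k i ^ 2), by positivity, fun j => ?_⟩
  rw [ww_sq, ← Real.sqrt_eq_rpow, jb, ← Real.sqrt_mul (by positivity)]
  apply Real.sqrt_le_sqrt
  have h := Finset.sum_mul_sq_le_sq_mul_sq Finset.univ (fun i => (j i : ℝ)) k
  have h1 : 0 ≤ ∑ i, k i ^ 2 := by positivity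
  have h2 : 0 ≤ ∑ i, (j i : ℝ) ^ 2 := by positivity
  unfold dotk
  nlinarith

lemma K_finite (k : Fin d → ℝ) (s : ℝ) (hs : ((d : ℝ) + 1) / 2 < s) :
    ∑' j : Freq d, ENNReal.ofReal (ww k j ^ 2 * jb j ^ (-(2 * s))) ≠ ⊤ := by
  obtain ⟨K, hK, h⟩ := ww_sq_le k
  have hS := (jb_summable (d := d) (1 - 2 * s) (by linarith)).mul_left K
  refine Summable.tsum_ofReal_ne_top (Summable.of_nonneg_of_le (fun j => ?_) (fun j => ?_) hS)
  · have := jb_pos j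
    positivity
  · have hj := jb_pos j
    calc _ ≤ K * jb j * jb j ^ (-(2*s)) := by gcongr; exact h j
      _ = _ := by rw [sub_eq_add_neg, Real.rpow_add hj, Real.rpow_one]; ring

lemma Bsum (k : Fin d → ℝ) (s : ℝ) (R : Coeffs d) :
    (∑' m, BB k R m)^2 ≤ (∑' j : Freq d, ENNReal.ofReal (ww k j ^ 2 * jb j ^ (-(2 * s)))) *
      ∑' m, AA k s R m ^ 2 := by
  refine le_trans (le_of_eq ?_) ((cs (fun j : Freq d => ENNReal.ofReal (ww k j ^ 2 * jb j ^ (-(2 * s))))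
    (fun j => ENNReal.ofReal (jb j ^ (2 * s) * ‖R j‖))).trans (le_of_eq ?_))
  · congr 1
    refine tsum_congr fun m => ?_
    have hj := jb_pos m
    rw [BB, ← ENNReal.ofReal_mul (by positivity)]
    congr 1
    rw [Real.rpow_neg hj.le]
    field_simp
  · congr 1
    refine tsum_congr fun m => ?_
    have hj := jb_pos m
    have hw := ww_pos k m
    rw [AA_sq, ← ENNReal.ofReal_pow (by positivity), ← ENNReal.ofReal_mul (by positivity), wt, ← ww_sq]
    congr 1
    rw [Real.rpow_neg hj.le]
    field_simp

lemma wt_nonneg (k : Fin d → ℝ) (s : ℝ) (u : Coeffs d) (j : Freq d) :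
    0 ≤ wt k s (1/2) j * ‖u j‖ ^ 2 := by
  have := jb_pos j
  unfold wt
  positivity

lemma memSob_iff (k : Fin d → ℝ) (s : ℝ) (u : Coeffs d) :
    MemSob k s (1/2) u ↔ ∑' m, AA k s u m ^ 2 ≠ ⊤ := by
  simp_rw [AA_sq]
  constructor
  · intro h; exact Summable.tsum_ofReal_ne_top h
  · intro h
    have := ENNReal.summable_toReal h
    refine this.congr fun j => ?_
    rw [ENNReal.toReal_ofReal (wt_nonneg k s u j)]

lemma sobNorm_eq (k : Fin d → ℝ) (s : ℝ) (u : Coeffs d) :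
    sobNorm k s (1/2) u = Real.sqrt (∑' m, AA k s u m ^ 2).toReal := by
  rw [sobNorm]
  congr 1
  simp_rw [AA_sq]
  rw [ENNReal.tsum_toReal_eq (by simp)]
  refine tsum_congr fun j => ?_
  rw [ENNReal.toReal_ofReal (wt_nonneg k s u j)]

/-- **Lemma 6.3(iv) (Energy bound for `a`).** Let `s > (d+1)/2` and `k ≥ 0`. There is a
constant `C = C(d,s,k)` such that for every holomorphic
`R ∈ H^{k,1/2}(𝕋^d) ∩ H^{s,1/2}(𝕋^d)`, the function
`a := i(P̄[conj(R)·∂_α R] − P[R·∂_α conj(R)])` satisfies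
`‖a‖_{H^{k,1/2}} ≤ C ‖R‖_{H^{k,1/2}} ‖R‖_{H^{s,1/2}}`. -/
theorem frequency_shift_energy_bound
    (d : ℕ) (hd : 1 ≤ d) (k : Fin d → ℝ) (hk : Indep k)
    (s : ℝ) (hs : ((d : ℝ) + 1) / 2 < s)
    (kexp : ℝ) (hkexp : 0 ≤ kexp) :
    ∃ C : ℝ, 0 < C ∧
      ∀ R : Coeffs d, Holo k R → MemSob k kexp (1/2) R → MemSob k s (1/2) R →
        MemSob k kexp (1/2) (aCf k R) ∧
        sobNorm k kexp (1/2) (aCf k R)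
          ≤ C * sobNorm k kexp (1/2) R * sobNorm k s (1/2) R := by
  set D := ENNReal.ofReal (2 ^ kexp) ^ 2 * 16 *
    (∑' j : Freq d, ENNReal.ofReal (ww k j ^ 2 * jb j ^ (-(2 * s)))) with hD
  have hDt : D ≠ ⊤ := by
    refine ENNReal.mul_ne_top (ENNReal.mul_ne_top (by simp) (by simp)) (K_finite k s hs)
  refine ⟨Real.sqrt D.toReal + 1, by positivity, fun R hR h1 h2 => ?_⟩
  have hb : ∑' j, AA k kexp (aCf k R) j ^ 2 ≤
      D * (∑' m, AA k kexp R m ^ 2) * (∑' m, AA k s R m ^ 2) := by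
    refine (asum k kexp hkexp R hR).trans ?_
    calc _ ≤ ENNReal.ofReal (2 ^ kexp) ^ 2 * 16 * (((∑' j : Freq d, ENNReal.ofReal
          (ww k j ^ 2 * jb j ^ (-(2 * s)))) * ∑' m, AA k s R m ^ 2) * ∑' m, AA k kexp R m ^ 2) := by
            gcongr
            exact Bsum k s R
      _ = _ := by rw [hD]; ring
  rw [memSob_iff] at h1 h2
  have hfin := ENNReal.mul_ne_top (ENNReal.mul_ne_top hDt h1) h2
  refine ⟨(memSob_iff _ _ _).2 (ne_top_of_le_ne_top hfin hb), ?_⟩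
  rw [sobNorm_eq, sobNorm_eq, sobNorm_eq]
  refine (Real.sqrt_le_sqrt (ENNReal.toReal_mono hfin hb)).trans ?_
  rw [ENNReal.toReal_mul, ENNReal.toReal_mul, Real.sqrt_mul (by positivity),
    Real.sqrt_mul (by positivity)]
  gcongr
  linarith

end
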